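/- arXiv:1909.04902 — 5 statements merged into one kernel-verified Lean document; each statement's English description precedes it below -/
import Mathlib

section
/- Let f : ℝ → ℝ be twice differentiable on [0, ∞) with f(s) > 0 for all s > 0, and suppose f''(s) ≤ f(s) for all s > 0. Assume there exist δ > 0 and S > 0 such that f(s) = sinh s for all s ∈ [0, δ] and f(s) = sinh s for all s ≥ S. Then f(s) = sinh s for all s ≥ 0. -/
/-- ODE rigidity (Remark 5.4): a function `f` twice differentiable on `[0,∞)`,
positive on `(0,∞)`, satisfying `f'' ≤ f` there, and agreeing with `sinh` both
near `0` and near `+∞`, must equal `sinh` on all of `[0,∞)`. -/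
theorem sinh_rigidity (f f' f'' : ℝ → ℝ)
    (hf' : ∀ s ∈ Set.Ici (0:ℝ), HasDerivWithinAt f (f' s) (Set.Ici 0) s)
    (hf'' : ∀ s ∈ Set.Ici (0:ℝ), HasDerivWithinAt f' (f'' s) (Set.Ici 0) s)
    (hpos : ∀ s : ℝ, 0 < s → 0 < f s)
    (hineq : ∀ s : ℝ, 0 < s → f'' s ≤ f s)
    (hzero : ∃ δ : ℝ, 0 < δ ∧ ∀ s ∈ Set.Icc (0:ℝ) δ, f s = Real.sinh s)
    (hinfty : ∃ S : ℝ, 0 < S ∧ ∀ s : ℝ, S ≤ s → f s = Real.sinh s) :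
    ∀ s : ℝ, 0 ≤ s → f s = Real.sinh s := by
  obtain ⟨δ, hδ, hzero⟩ := hzero
  obtain ⟨S, hS, hinfty⟩ := hinfty
  have deriv_eq_cosh {s : ℝ} (hs : 0 ≤ s)
      (h : f =ᶠ[nhdsWithin s (Set.Ici 0)] Real.sinh) : f' s = Real.cosh s :=
    (uniqueDiffOn_Ici (0 : ℝ) s hs).eq_deriv _ (hf' s hs)
      ((Real.hasDerivAt_sinh s).hasDerivWithinAt.congr_of_eventuallyEq_of_mem h hs)
  have eq_one {s : ℝ} (hfs : f s = Real.sinh s) (hfs' : f' s = Real.cosh s) :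
      (f' s - f s) * Real.exp s = 1 := by
    rw [hfs, hfs', Real.cosh_sub_sinh, ← Real.exp_add, neg_add_cancel, Real.exp_zero]
  have h_start : (f' 0 - f 0) * Real.exp 0 = 1 := by
    refine eq_one (hzero 0 ⟨le_rfl, hδ.le⟩) (deriv_eq_cosh le_rfl ?_)
    filter_upwards [self_mem_nhdsWithin, mem_nhdsWithin_of_mem_nhds (Iio_mem_nhds hδ)]
      with s h0 h1 using hzero s ⟨h0, le_of_lt h1⟩
  have h_end {s : ℝ} (hs : S < s) : (f' s - f s) * Real.exp s = 1 := by
    refine eq_one (hinfty s hs.le) (deriv_eq_cosh (hS.trans hs).le ?_)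
    filter_upwards [mem_nhdsWithin_of_mem_nhds (Ioi_mem_nhds hs)]
      with t ht using hinfty t (le_of_lt ht)
  have h_anti : AntitoneOn (fun s => (f' s - f s) * Real.exp s) (Set.Ici 0) := by
    have h_deriv (s : ℝ) (hs : s ∈ Set.Ici (0 : ℝ)) :=
      ((hf'' s hs).sub (hf' s hs)).mul (Real.hasDerivAt_exp s).hasDerivWithinAt
    refine antitoneOn_of_hasDerivWithinAt_nonpos (convex_Ici 0)
      (fun s hs => (h_deriv s hs).continuousWithinAt)
      (fun s hs => (h_deriv s (interior_subset hs)).mono interior_subset) fun s hs => ?_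
    rw [interior_Ici] at hs
    simp only [Pi.sub_apply]
    nlinarith [hineq s hs, Real.exp_pos s]
  have h_const {s : ℝ} (hs : 0 ≤ s) : (f' s - f s) * Real.exp s = 1 := by
    have hlt : S < max s (S + 1) := lt_max_of_lt_right (lt_add_one S)
    exact le_antisymm ((h_anti Set.self_mem_Ici hs hs).trans_eq h_start)
      ((h_end hlt).symm.trans_le
        (h_anti hs (hs.trans (le_max_left _ _)) (le_max_left _ _)))
  have u_deriv (s : ℝ) (hs : s ∈ Set.Ici (0 : ℝ)) :
      HasDerivWithinAt (fun s => (f s - Real.sinh s) * Real.exp (-s)) 0 (Set.Ici 0) s := by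
    refine (((hf' s hs).sub (Real.hasDerivAt_sinh s).hasDerivWithinAt).mul
      (hasDerivAt_neg s).exp.hasDerivWithinAt).congr_deriv ?_
    have h : f' s - f s = Real.cosh s - Real.sinh s := by
      rw [Real.cosh_sub_sinh, Real.exp_neg]
      exact eq_inv_of_mul_eq_one_left (h_const hs)
    simp only [Pi.sub_apply]
    linear_combination Real.exp (-s) * h
  intro s hs
  have hu := constant_of_has_deriv_right_zero
    (fun t ht => (u_deriv t ht.1).continuousWithinAt.mono Set.Icc_subset_Ici_self)
    (fun t ht => (u_deriv t ht.1).mono (Set.Ici_subset_Ici.2 ht.1)) s (Set.right_mem_Icc.2 hs)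
  rw [hzero 0 ⟨le_rfl, hδ.le⟩, sub_self, zero_mul] at hu
  exact sub_eq_zero.1 ((mul_eq_zero.1 hu).resolve_right (Real.exp_ne_zero _))
end

section
/- For every integer n ≥ 2 and every real ε with 0 < ε < 1, there exists a smooth function f : (0, ∞) → (0, ∞) such that: f(s) = sinh s for all s in some neighborhood of 0 and for all s ≥ 4/ε; f(1/ε) = f(3/ε) = ε^{1/n}; f(s) ≥ ε^{1/n} for all s ∈ [1/ε, 3/ε]; and consequently f(1/ε)^n + f(3/ε)^n ≤ ε · ∫_{1/ε}^{3/ε} f(s)^n ds. -/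
/-- A smooth function that agrees with `sinh` outside `(1 / (2 * ε), 4 / ε)` and with the constant
`c` on `[1 / ε, 3 / ε]`. -/
noncomputable def flattenedSinh (ε c s : ℝ) : ℝ :=
  Real.sinh s + Real.smoothTransition (2 * (ε * s) - 1) *
    (1 - Real.smoothTransition (ε * s - 3)) * (c - Real.sinh s)

theorem contDiff_flattenedSinh (ε c : ℝ) : ContDiff ℝ (⊤ : ℕ∞) (flattenedSinh ε c) := by
  have h₁ : ContDiff ℝ (⊤ : ℕ∞) fun s : ℝ => Real.smoothTransition (2 * (ε * s) - 1) :=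
    Real.smoothTransition.contDiff.comp (by fun_prop)
  have h₂ : ContDiff ℝ (⊤ : ℕ∞) fun s : ℝ => Real.smoothTransition (ε * s - 3) :=
    Real.smoothTransition.contDiff.comp (by fun_prop)
  exact Real.contDiff_sinh.add
    ((h₁.mul (contDiff_const.sub h₂)).mul (contDiff_const.sub Real.contDiff_sinh))

theorem flattenedSinh_pos {ε c s : ℝ} (hc : 0 < c) (hs : 0 < s) : 0 < flattenedSinh ε c s := by
  have hsinh : 0 < Real.sinh s := Real.sinh_pos_iff.2 hs
  unfold flattenedSinh
  set p := Real.smoothTransition (2 * (ε * s) - 1)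
  set q := 1 - Real.smoothTransition (ε * s - 3)
  have hp₀ : 0 ≤ p := Real.smoothTransition.nonneg _
  have hp₁ : p ≤ 1 := Real.smoothTransition.le_one _
  have hq₀ : 0 ≤ q := sub_nonneg.2 (Real.smoothTransition.le_one _)
  have hq₁ : q ≤ 1 := sub_le_self _ (Real.smoothTransition.nonneg _)
  have hpq₁ : p * q ≤ 1 := mul_le_one₀ hp₁ hq₀ hq₁
  have := (convex_Ioi (0 : ℝ)) (x := Real.sinh s) hsinh (y := c) hc (sub_nonneg.2 hpq₁)
    (mul_nonneg hp₀ hq₀) (by ring)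
  simp only [smul_eq_mul, Set.mem_Ioi] at this
  linarith

theorem flattenedSinh_of_mul_le {ε c s : ℝ} (h : 2 * (ε * s) ≤ 1) :
    flattenedSinh ε c s = Real.sinh s := by
  simp [flattenedSinh, Real.smoothTransition.zero_of_nonpos (sub_nonpos.2 h)]

theorem flattenedSinh_of_le_mul {ε c s : ℝ} (h : 4 ≤ ε * s) :
    flattenedSinh ε c s = Real.sinh s := by
  simp [flattenedSinh,
    Real.smoothTransition.one_of_one_le (show 1 ≤ ε * s - 3 by linarith)]

theorem flattenedSinh_of_mem_Icc {ε c s : ℝ} (hε : 0 < ε) (hs : s ∈ Set.Icc (1 / ε) (3 / ε)) :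
    flattenedSinh ε c s = c := by
  have h₁ : 1 ≤ ε * s := (div_le_iff₀' hε).1 hs.1
  have h₃ : ε * s ≤ 3 := (le_div_iff₀' hε).1 hs.2
  simp [flattenedSinh, Real.smoothTransition.zero_of_nonpos (sub_nonpos.2 h₃),
    Real.smoothTransition.one_of_one_le (show 1 ≤ 2 * (ε * s) - 1 by linarith)]


/-- Example 4.1: for every `n ≥ 2` and `0 < ε < 1` there is a smooth positive warping
function `f` on `(0,∞)` equal to `sinh` near `0` and for `s ≥ 4/ε`, taking the value
`ε^(1/n)` at `1/ε` and `3/ε`, bounded below by `ε^(1/n)` on `[1/ε, 3/ε]`, and for which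
the isoperimetric quotient of the domain `(1/ε, 3/ε) × Sⁿ` is at most `ε`. -/
theorem small_cheeger_warping (n : ℕ) (hn : 2 ≤ n) (ε : ℝ) (hε0 : 0 < ε) (hε1 : ε < 1) :
    ∃ f : ℝ → ℝ,
      ContDiffOn ℝ (⊤ : ℕ∞) f (Set.Ioi 0) ∧
      (∀ s : ℝ, 0 < s → 0 < f s) ∧
      (∃ δ : ℝ, 0 < δ ∧ ∀ s ∈ Set.Ioc (0:ℝ) δ, f s = Real.sinh s) ∧
      (∀ s : ℝ, 4 / ε ≤ s → f s = Real.sinh s) ∧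
      f (1 / ε) = ε ^ ((1:ℝ) / n) ∧
      f (3 / ε) = ε ^ ((1:ℝ) / n) ∧
      (∀ s ∈ Set.Icc (1 / ε) (3 / ε), ε ^ ((1:ℝ) / n) ≤ f s) ∧
      f (1 / ε) ^ n + f (3 / ε) ^ n ≤ ε * ∫ s in (1 / ε)..(3 / ε), f s ^ n := by
  set c : ℝ := ε ^ ((1:ℝ) / n)
  have hc : 0 < c := Real.rpow_pos_of_pos hε0 _
  have hcn : c ^ n = ε := by
    simpa only [c, one_div] using Real.rpow_inv_natCast_pow hε0.le (by lia : n ≠ 0)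
  have hle : 1 / ε ≤ 3 / ε := by gcongr; norm_num
  have hconst : ∀ s ∈ Set.Icc (1 / ε) (3 / ε), flattenedSinh ε c s = c :=
    fun s hs => flattenedSinh_of_mem_Icc hε0 hs
  have h₁ := hconst _ (Set.left_mem_Icc.2 hle)
  have h₃ := hconst _ (Set.right_mem_Icc.2 hle)
  refine ⟨flattenedSinh ε c, (contDiff_flattenedSinh ε c).contDiffOn,
    fun s hs => flattenedSinh_pos hc hs,
    ⟨1 / (2 * ε), by positivity, fun s hs => flattenedSinh_of_mul_le ?_⟩,
    fun s hs => flattenedSinh_of_le_mul ((div_le_iff₀' hε0).1 hs),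
    h₁, h₃, fun s hs => (hconst s hs).ge, ?_⟩
  · have := (le_div_iff₀' (by positivity)).1 hs.2
    linarith
  · have hint : ∫ s in (1 / ε)..(3 / ε), flattenedSinh ε c s ^ n = 2 := by
      rw [intervalIntegral.integral_congr (g := fun _ => ε) fun s hs => by
        rw [Set.uIcc_of_le hle] at hs
        simp only [hconst s hs, hcn]]
      rw [intervalIntegral.integral_const, smul_eq_mul]
      field_simp
      norm_num
    rw [h₁, h₃, hcn, hint]
    linarith
end

section
/- Let n ≥ 3 be an integer, α ∈ (0,1), r₀ > 0, K > 0, C₀ ≥ 0, C₁ ≥ 0, and b ∈ ℝ. Let w be a continuous function on (0, r₀] with w(s) = 1 + b s² + O(s^{2+α}) as s → 0⁺, meaning there exist C > 0 and δ ∈ (0, r₀] with |w(s) − (1 + b s²)| ≤ C s^{2+α} for all 0 < s < δ. Define, for r ∈ (0, r₀), A(r) = K r^{−n} w(r) + C₀ and V(r) = C₁ + K ∫_r^{r₀} s^{−(n+1)} w(s) ds. Then A(r)/V(r) = n·(1 − (2b/(n−2)) r²) + O(r^{2+α}) as r → 0⁺; that is, there exist C' > 0 and r₁ ∈ (0, r₀)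 with |A(r)/V(r) − n(1 − (2b/(n−2)) r²)| ≤ C' r^{2+α} for all 0 < r < r₁. -/
open Filter Topology Asymptotics Set

/-- A local power bound at `0⁺` for a continuous function on `(0, r₀]` extends to `(0, r₀]`. -/
lemma exists_rpow_bound_on_Ioc {f : ℝ → ℝ} {r₀ β C δ : ℝ} (hf : ContinuousOn f (Ioc 0 r₀))
    (hδ : 0 < δ) (h : ∀ s, 0 < s → s < δ → |f s| ≤ C * s ^ β) :
    ∃ M, ∀ s ∈ Ioc 0 r₀, |f s| ≤ M * s ^ β := by
  have hsub : Icc (δ / 2) r₀ ⊆ Ioc 0 r₀ := fun s hs => ⟨by linarith [hs.1], hs.2⟩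
  have hcont : ContinuousOn (fun s => f s / s ^ β) (Icc (δ / 2) r₀) := by
    refine (hf.mono hsub).div (fun s hs => ?_) fun s hs => (Real.rpow_pos_of_pos (hsub hs).1 _).ne'
    exact (Real.continuousAt_rpow_const _ _ (Or.inl (hsub hs).1.ne')).continuousWithinAt
  obtain ⟨D, hD⟩ := isCompact_Icc.exists_bound_of_continuousOn hcont
  refine ⟨max C D, fun s hs => ?_⟩
  have hpos := Real.rpow_pos_of_pos hs.1 β
  rcases lt_or_ge s δ with hsδ | hsδ
  · exact (h s hs.1 hsδ).trans (by gcongr; exact le_max_left _ _)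
  · have := hD s ⟨by linarith, hs.2⟩
    rw [Real.norm_eq_abs, abs_div, abs_of_pos hpos, div_le_iff₀ hpos] at this
    exact this.trans (by gcongr; exact le_max_right _ _)

lemma integral_rpow_of_pos {a c q : ℝ} (ha : 0 < a) (hc : 0 < c) (hq : q ≠ 0) :
    ∫ s in a..c, s ^ (q - 1) = (c ^ q - a ^ q) / q := by
  rw [integral_rpow (Or.inr ⟨fun h => hq (by linarith), notMem_uIcc_of_lt ha hc⟩),
    sub_add_cancel]

lemma abs_integral_sub_le {w : ℝ → ℝ} {r₀ p β b M r : ℝ} (hp : 2 < p) (hβ : β < p)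
    (hM : ∀ s ∈ Ioc 0 r₀, |w s - (1 + b * s ^ 2)| ≤ M * s ^ β)
    (hw : ContinuousOn w (Ioc 0 r₀)) (hr : 0 < r) (hr₀ : r ≤ r₀) :
    |(∫ s in r..r₀, s ^ (-(p + 1)) * w s) -
        ((r ^ (-p) - r₀ ^ (-p)) / p + b * ((r ^ (2 - p) - r₀ ^ (2 - p)) / (p - 2)))| ≤
      M * (r ^ (β - p) / (p - β)) := by
  have h₀ : 0 < r₀ := hr.trans_le hr₀
  have hM₀ : 0 ≤ M := by
    have := (abs_nonneg _).trans (hM r₀ ⟨h₀, le_rfl⟩)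
    exact nonneg_of_mul_nonneg_left this (Real.rpow_pos_of_pos h₀ _)
  have hsub : uIcc r r₀ ⊆ Ioc 0 r₀ := by
    rw [uIcc_of_le hr₀]; exact fun s hs => ⟨hr.trans_le hs.1, hs.2⟩
  have hrpow (q : ℝ) : IntervalIntegrable (fun s : ℝ => s ^ q) MeasureTheory.volume r r₀ :=
    intervalIntegral.intervalIntegrable_rpow (Or.inr (notMem_uIcc_of_lt hr h₀))
  have hcont (q : ℝ) : ContinuousOn (fun s : ℝ => s ^ q) (uIcc r r₀) := fun s hs =>
    (Real.continuousAt_rpow_const _ _ (Or.inl (hsub hs).1.ne')).continuousWithinAt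
  have hwint : IntervalIntegrable (fun s => s ^ (-(p + 1)) * w s) MeasureTheory.volume r r₀ :=
    ((hcont _).mul (hw.mono hsub)).intervalIntegrable
  have hmain : (r ^ (-p) - r₀ ^ (-p)) / p + b * ((r ^ (2 - p) - r₀ ^ (2 - p)) / (p - 2)) =
      ∫ s in r..r₀, (s ^ (-p - 1) + b * s ^ (2 - p - 1)) := by
    rw [intervalIntegral.integral_add (hrpow _) ((hrpow _).const_mul b),
      intervalIntegral.integral_const_mul, integral_rpow_of_pos hr h₀ (by linarith),
      integral_rpow_of_pos hr h₀ (by linarith)]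
    have : p ≠ 0 := by linarith
    have : p - 2 ≠ 0 := by linarith
    have : 2 - p ≠ 0 := by linarith
    field_simp
    ring
  rw [hmain, ← intervalIntegral.integral_sub hwint ((hrpow _).add ((hrpow _).const_mul b)),
    ← Real.norm_eq_abs]
  have hbound : ∀ s ∈ Ioc r r₀,
      ‖s ^ (-(p + 1)) * w s - (s ^ (-p - 1) + b * s ^ (2 - p - 1))‖ ≤ M * s ^ (β - p - 1) := by
    intro s hs
    have hs₀ : 0 < s := hr.trans hs.1
    have h₁ : s ^ (2 - p - 1) = s ^ (-(p + 1)) * s ^ 2 := by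
      rw [← Real.rpow_natCast s 2, ← Real.rpow_add hs₀]; congr 1; push_cast; ring
    have h₂ : s ^ (β - p - 1) = s ^ (-(p + 1)) * s ^ β := by
      rw [← Real.rpow_add hs₀]; congr 1; ring
    have h₃ : -p - 1 = -(p + 1) := by ring
    have hpos := Real.rpow_pos_of_pos hs₀ (-(p + 1))
    calc _ = s ^ (-(p + 1)) * |w s - (1 + b * s ^ 2)| := by
          rw [h₁, h₃, Real.norm_eq_abs, ← abs_of_pos hpos, ← abs_mul, abs_of_pos hpos]
          congr 1; ring
      _ ≤ s ^ (-(p + 1)) * (M * s ^ β) := by gcongr; exact hM s ⟨hs₀, hs.2⟩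
      _ = _ := by rw [h₂]; ring
  refine (intervalIntegral.norm_integral_le_of_norm_le hr₀
    (Eventually.of_forall hbound) ((hrpow _).const_mul M)).trans ?_
  rw [intervalIntegral.integral_const_mul, integral_rpow_of_pos hr h₀ (by linarith)]
  refine mul_le_mul_of_nonneg_left ?_ hM₀
  rw [← neg_sub p β, div_neg, ← neg_div, neg_sub]
  have := Real.rpow_pos_of_pos h₀ (-(p - β))
  have : 0 < p - β := by linarith
  gcongr
  linarith

lemma isBigO_rpow_rpow_nhdsGT_zero {p q : ℝ} (h : q ≤ p) :
    (fun r : ℝ => r ^ p) =O[𝓝[>] 0] fun r => r ^ q := by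
  refine IsBigO.of_bound 1 ?_
  filter_upwards [Ioo_mem_nhdsGT one_pos] with r hr
  rw [one_mul, Real.norm_of_nonneg (Real.rpow_nonneg hr.1.le _),
    Real.norm_of_nonneg (Real.rpow_nonneg hr.1.le _)]
  exact Real.rpow_le_rpow_of_exponent_ge hr.1 hr.2.le h

lemma isBigO_rpow_mul_integral_sub {w : ℝ → ℝ} {r₀ p β b M : ℝ} (h₀ : 0 < r₀) (hp : 2 < p)
    (hβ : β < p) (hM : ∀ s ∈ Ioc 0 r₀, |w s - (1 + b * s ^ 2)| ≤ M * s ^ β)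
    (hw : ContinuousOn w (Ioc 0 r₀)) :
    (fun r => r ^ p * (∫ s in r..r₀, s ^ (-(p + 1)) * w s) - (1 / p + b / (p - 2) * r ^ 2))
      =O[𝓝[>] 0] fun r => r ^ β := by
  set c := -(r₀ ^ (-p) / p + b * (r₀ ^ (2 - p) / (p - 2))) with hc
  have hrem : (fun r => r ^ p * ((∫ s in r..r₀, s ^ (-(p + 1)) * w s) -
      ((r ^ (-p) - r₀ ^ (-p)) / p + b * ((r ^ (2 - p) - r₀ ^ (2 - p)) / (p - 2)))))
      =O[𝓝[>] 0] fun r => r ^ β := by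
    refine IsBigO.of_bound (M / (p - β)) ?_
    filter_upwards [Ioo_mem_nhdsGT h₀] with r hr
    have hpos := Real.rpow_pos_of_pos hr.1 p
    rw [norm_mul, Real.norm_of_nonneg hpos.le,
      Real.norm_of_nonneg (Real.rpow_nonneg hr.1.le _)]
    calc _ ≤ r ^ p * (M * (r ^ (β - p) / (p - β))) := by
          gcongr; exact abs_integral_sub_le hp hβ hM hw hr.1 hr.2.le
      _ = _ := by rw [Real.rpow_sub hr.1]; field_simp
  refine (hrem.add ((isBigO_rpow_rpow_nhdsGT_zero hβ.le).const_mul_left c)).congr' ?_ .rfl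
  filter_upwards [self_mem_nhdsWithin] with r (hr : 0 < r)
  have hpos := Real.rpow_pos_of_pos hr p
  have h₁ : r ^ (-p) = (r ^ p)⁻¹ := Real.rpow_neg hr.le p
  have h₂ : r ^ (2 - p) = r ^ 2 * (r ^ p)⁻¹ := by
    rw [Real.rpow_sub hr, Real.rpow_two, div_eq_mul_inv]
  have : p ≠ 0 := by linarith
  have : p - 2 ≠ 0 := by linarith
  rw [hc, h₁, h₂]
  field_simp
  ring

lemma isBigO_div_sub_of_expansions {a v g : ℝ → ℝ} {p b : ℝ} (hp : 2 < p)
    (ha : (fun r => a r - (1 + b * r ^ 2)) =O[𝓝[>] 0] g)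
    (hv : (fun r => v r - (1 / p + b / (p - 2) * r ^ 2)) =O[𝓝[>] 0] g)
    (h4 : (fun r : ℝ => r ^ 4) =O[𝓝[>] 0] g) (hg : Tendsto g (𝓝[>] 0) (𝓝 0)) :
    (fun r => a r / v r - p * (1 - 2 * b / (p - 2) * r ^ 2)) =O[𝓝[>] 0] g := by
  have hp₀ : p ≠ 0 := by linarith
  have hp₂ : p - 2 ≠ 0 := by linarith
  have hlim : Tendsto v (𝓝[>] 0) (𝓝 (1 / p)) := by
    have h₁ : Tendsto (fun r : ℝ => 1 / p + b / (p - 2) * r ^ 2) (𝓝[>] 0) (𝓝 (1 / p)) :=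
      ((by fun_prop : Continuous fun r : ℝ => 1 / p + b / (p - 2) * r ^ 2).tendsto' 0 _
        (by simp)).mono_left nhdsWithin_le_nhds
    simpa using (hv.trans_tendsto hg).add h₁
  have hinv : (fun r => (v r)⁻¹) =O[𝓝[>] 0] fun _ => (1 : ℝ) :=
    (hlim.inv₀ (by positivity)).isBigO_one ℝ
  have hq : (fun r : ℝ => p * (1 - 2 * b / (p - 2) * r ^ 2)) =O[𝓝[>] 0] fun _ => (1 : ℝ) :=
    (((by fun_prop : Continuous fun r : ℝ => p * (1 - 2 * b / (p - 2) * r ^ 2)).tendsto 0).mono_left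
      nhdsWithin_le_nhds).isBigO_one ℝ
  have hqv := hq.mul hv
  have hnum := (ha.sub (by simpa only [one_mul] using hqv)).add
    (h4.const_mul_left (2 * b ^ 2 * p / (p - 2) ^ 2))
  refine (by simpa only [mul_one] using hnum.mul hinv : IsBigO _ _ g).congr' ?_ .rfl
  filter_upwards [hlim.eventually_ne (by positivity)] with r hr
  field_simp
  ring


/-- Proposition 3.3, expansion of the isoperimetric quotient for `n ≥ 3`: with
`w(s) = 1 + b s² + O(s^{2+α})`, `A(r) = K r^{-n} w(r) + C₀` and
`V(r) = C₁ + K ∫_r^{r₀} s^{-(n+1)} w(s) ds`, one has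
`A(r)/V(r) = n (1 - (2b/(n-2)) r²) + O(r^{2+α})` as `r → 0⁺`. -/
theorem isoperimetric_quotient_expansion (n : ℕ) (hn : 3 ≤ n) (α : ℝ)
    (hα : α ∈ Set.Ioo (0:ℝ) 1) (r₀ K C₀ C₁ : ℝ) (hr₀ : 0 < r₀) (hK : 0 < K)
    (hC₀ : 0 ≤ C₀) (hC₁ : 0 ≤ C₁) (b : ℝ) (w : ℝ → ℝ)
    (hw : ContinuousOn w (Set.Ioc 0 r₀))
    (hexp : ∃ C : ℝ, 0 < C ∧ ∃ δ ∈ Set.Ioc (0:ℝ) r₀, ∀ s : ℝ, 0 < s → s < δ →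
      |w s - (1 + b * s ^ 2)| ≤ C * s ^ ((2:ℝ) + α)) :
    ∃ C' : ℝ, 0 < C' ∧ ∃ r₁ ∈ Set.Ioo (0:ℝ) r₀, ∀ r : ℝ, 0 < r → r < r₁ →
      |(K * r ^ (-(n:ℝ)) * w r + C₀) /
          (C₁ + K * ∫ s in r..r₀, s ^ (-((n:ℝ) + 1)) * w s) -
        (n:ℝ) * (1 - (2 * b / ((n:ℝ) - 2)) * r ^ 2)| ≤ C' * r ^ ((2:ℝ) + α) := by
  obtain ⟨C, -, δ, hδ, hCδ⟩ := hexp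
  have hn' : (3 : ℝ) ≤ n := by exact_mod_cast hn
  have hp : (2 : ℝ) < n := by linarith
  have hβ : 2 + α < n := by linarith [hα.2]
  have hβ₀ : 0 < 2 + α := by linarith [hα.1]
  obtain ⟨M, hM⟩ := exists_rpow_bound_on_Ioc
    (hw.sub (by fun_prop : ContinuousOn (fun s : ℝ => 1 + b * s ^ 2) _)) hδ.1 hCδ
  have hpow : (fun r : ℝ => r ^ (n : ℝ)) =O[𝓝[>] 0] fun r => r ^ (2 + α) :=
    isBigO_rpow_rpow_nhdsGT_zero hβ.le
  have hw' : (fun r => w r - (1 + b * r ^ 2)) =O[𝓝[>] 0] fun r => r ^ (2 + α) := by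
    refine IsBigO.of_bound M ?_
    filter_upwards [Ioo_mem_nhdsGT hr₀] with r hr
    rw [Real.norm_of_nonneg (Real.rpow_nonneg hr.1.le _)]
    exact hM r ⟨hr.1, hr.2.le⟩
  have hA : (fun r => (w r + C₀ / K * r ^ (n : ℝ)) - (1 + b * r ^ 2))
      =O[𝓝[>] 0] fun r => r ^ (2 + α) :=
    (hw'.add (hpow.const_mul_left (C₀ / K))).congr_left fun r => by ring
  have hV : (fun r => (r ^ (n : ℝ) * (∫ s in r..r₀, s ^ (-((n : ℝ) + 1)) * w s) +
      C₁ / K * r ^ (n : ℝ)) - (1 / (n : ℝ) + b / ((n : ℝ) - 2) * r ^ 2))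
      =O[𝓝[>] 0] fun r => r ^ (2 + α) :=
    ((isBigO_rpow_mul_integral_sub hr₀ hp hβ hM hw).add
      (hpow.const_mul_left (C₁ / K))).congr_left fun r => by ring
  have h4 : (fun r : ℝ => r ^ 4) =O[𝓝[>] 0] fun r => r ^ (2 + α) := by
    simpa using isBigO_rpow_rpow_nhdsGT_zero
      (by push_cast; linarith [hα.2] : 2 + α ≤ ((4 : ℕ) : ℝ))
  have hg : Tendsto (fun r : ℝ => r ^ (2 + α)) (𝓝[>] 0) (𝓝 0) := by
    have := (Real.continuousAt_rpow_const 0 (2 + α) (Or.inr hβ₀.le)).tendsto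
    rw [Real.zero_rpow hβ₀.ne'] at this
    exact this.mono_left nhdsWithin_le_nhds
  obtain ⟨C', hC', hO⟩ := (isBigO_div_sub_of_expansions hp hA hV h4 hg).exists_pos
  obtain ⟨u, hu, hsub⟩ := mem_nhdsGT_iff_exists_Ioo_subset.1 hO.bound
  refine ⟨C', hC', min u (r₀ / 2), ⟨lt_min hu (by linarith), ?_⟩, fun r hr hru => ?_⟩
  · exact (min_le_right _ _).trans_lt (by linarith)
  have hbound := hsub ⟨hr, hru.trans_le (min_le_left _ _)⟩
  have hpos := Real.rpow_pos_of_pos hr (n : ℝ)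
  have hquot : (K * r ^ (-(n : ℝ)) * w r + C₀) /
      (C₁ + K * ∫ s in r..r₀, s ^ (-((n : ℝ) + 1)) * w s) =
      (w r + C₀ / K * r ^ (n : ℝ)) / (r ^ (n : ℝ) *
        (∫ s in r..r₀, s ^ (-((n : ℝ) + 1)) * w s) + C₁ / K * r ^ (n : ℝ)) := by
    rw [← mul_div_mul_left _ _ (div_pos hpos hK).ne', Real.rpow_neg hr.le]
    congr 1 <;> field_simp
    ring
  rw [mem_ofPred_eq, Real.norm_eq_abs, Real.norm_of_nonneg (Real.rpow_nonneg hr.le _)] at hbound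
  rwa [hquot]
end

section
/- Let n ≥ 3 be an integer, α ∈ (0,1), r₀ > 0, K > 0, C₀ ≥ 0, C₁ ≥ 0, and b > 0. Let w be a continuous function on (0, r₀] with w(s) = 1 + b s² + O(s^{2+α}) as s → 0⁺, meaning there exist C > 0 and δ ∈ (0, r₀] with |w(s) − (1 + b s²)| ≤ C s^{2+α} for all 0 < s < δ. Define, for r ∈ (0, r₀), A(r) = K r^{−n} w(r) + C₀ and V(r) = C₁ + K ∫_r^{r₀} s^{−(n+1)} w(s) ds. Then there exists r₁ ∈ (0, r₀) such that A(r) < n V(r) for all r ∈ (0, r₁). -/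
open Filter Topology Set in
/-- A remainder of order `s ^ (2 + α)` with `α > 0` is eventually dominated by `ε * s ^ 2`. -/
theorem exists_forall_abs_sub_le_mul_sq {f g : ℝ → ℝ} {α C δ ε : ℝ} (hα : 0 < α) (hδ : 0 < δ)
    (hε : 0 < ε) (h : ∀ s : ℝ, 0 < s → s < δ → |f s - g s| ≤ C * s ^ ((2:ℝ) + α)) :
    ∃ d ∈ Ioo 0 δ, ∀ s ∈ Ioc 0 d, |f s - g s| ≤ ε * s ^ 2 := by
  have hlim : Tendsto (fun s : ℝ => C * s ^ α) (𝓝[>] 0) (𝓝 0) := by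
    have h0 : ContinuousAt (fun s : ℝ => C * s ^ α) 0 :=
      continuousAt_const.mul (Real.continuousAt_rpow_const 0 α (Or.inr hα.le))
    have h1 := h0.tendsto
    rw [Real.zero_rpow hα.ne', mul_zero] at h1
    exact h1.mono_left nhdsWithin_le_nhds
  obtain ⟨u, hu, hus⟩ := mem_nhdsGT_iff_exists_Ioo_subset.mp
    (hlim.eventually (gt_mem_nhds hε))
  have hu0 : 0 < u := hu
  have hmin : 0 < min u δ := lt_min hu0 hδ
  refine ⟨min u δ / 2, ⟨by positivity, by linarith [min_le_right u δ]⟩, fun s hs => ?_⟩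
  have hs0 : 0 < s := hs.1
  have hsu : s < u := by linarith [min_le_left u δ, hs.2]
  have hsδ : s < δ := by linarith [min_le_right u δ, hs.2]
  have hlt : C * s ^ α < ε := hus ⟨hs0, hsu⟩
  refine (h s hs0 hsδ).trans ?_
  rw [Real.rpow_add hs0, Real.rpow_two]
  nlinarith [sq_nonneg s]

/-- Closed form of the integral of `s ^ (-(n + 1)) * (1 + c * s ^ 2)` away from the origin. -/
theorem integral_rpow_neg_mul_one_add_sq {n c r d : ℝ} (hn : 2 < n) (hr : 0 < r) (hd : 0 < d) :
    ∫ s in r..d, s ^ (-(n + 1)) * (1 + c * s ^ 2) =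
      (r ^ (-n) - d ^ (-n)) / n + c * ((r ^ (2 - n) - d ^ (2 - n)) / (n - 2)) := by
  have h0 : (0:ℝ) ∉ Set.uIcc r d := Set.notMem_uIcc_of_lt hr hd
  have hcongr : ∫ s in r..d, s ^ (-(n + 1)) * (1 + c * s ^ 2) =
      ∫ s in r..d, (s ^ (-(n + 1)) + c * s ^ (1 - n)) := by
    refine intervalIntegral.integral_congr fun s hs => ?_
    have hs0 : 0 < s := (lt_min hr hd).trans_le hs.1
    have : s ^ (1 - n) = s ^ (-(n + 1)) * s ^ 2 := by
      rw [← Real.rpow_two, ← Real.rpow_add hs0]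
      ring_nf
    simp only [this]
    ring
  rw [hcongr, intervalIntegral.integral_add (intervalIntegral.intervalIntegrable_rpow (Or.inr h0))
    ((intervalIntegral.intervalIntegrable_rpow (Or.inr h0)).const_mul c),
    intervalIntegral.integral_const_mul, integral_rpow (Or.inr ⟨by linarith, h0⟩),
    integral_rpow (Or.inr ⟨by linarith, h0⟩)]
  have e1 : -(n + 1) + 1 = -n := by ring
  have e2 : 1 - n + 1 = 2 - n := by ring
  have hn0 : n ≠ 0 := by linarith
  have hn2 : n - 2 ≠ 0 := by linarith
  have hn2' : 2 - n ≠ 0 := by linarith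
  rw [e1, e2, ← neg_sub n 2, div_neg, div_neg]
  ring

open Filter Topology Set in
/-- Proposition 3.3, second part for `n ≥ 3`: with `w(s) = 1 + b s² + O(s^{2+α})`,
`b > 0`, `A(r) = K r^{-n} w(r) + C₀` and `V(r) = C₁ + K ∫_r^{r₀} s^{-(n+1)} w(s) ds`,
one has `A(r) < n V(r)` for all sufficiently small `r > 0`. -/
theorem strict_isoperimetric_failure (n : ℕ) (hn : 3 ≤ n) (α : ℝ)
    (hα : α ∈ Set.Ioo (0:ℝ) 1) (r₀ K C₀ C₁ : ℝ) (hr₀ : 0 < r₀) (hK : 0 < K)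
    (hC₀ : 0 ≤ C₀) (hC₁ : 0 ≤ C₁) (b : ℝ) (hb : 0 < b) (w : ℝ → ℝ)
    (hw : ContinuousOn w (Set.Ioc 0 r₀))
    (hexp : ∃ C : ℝ, 0 < C ∧ ∃ δ ∈ Set.Ioc (0:ℝ) r₀, ∀ s : ℝ, 0 < s → s < δ →
      |w s - (1 + b * s ^ 2)| ≤ C * s ^ ((2:ℝ) + α)) :
    ∃ r₁ ∈ Set.Ioo (0:ℝ) r₀, ∀ r : ℝ, 0 < r → r < r₁ →
      K * r ^ (-(n:ℝ)) * w r + C₀ <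
        (n:ℝ) * (C₁ + K * ∫ s in r..r₀, s ^ (-((n:ℝ) + 1)) * w s) := by
  obtain ⟨C, -, δ, hδ, hCδ⟩ := hexp
  have hn3 : (3:ℝ) ≤ n := by exact_mod_cast hn
  have hn0 : (0:ℝ) < n := by linarith
  have hn2 : (0:ℝ) < n - 2 := by linarith
  obtain ⟨d, hd, hwd⟩ := exists_forall_abs_sub_le_mul_sq (g := fun s => 1 + b * s ^ 2)
    hα.1 hδ.1 (div_pos hb hn0) hCδ
  have hd0 : 0 < d := hd.1
  have hdr : d < r₀ := hd.2.trans_le hδ.2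
  have hcont : ContinuousOn (fun s : ℝ => s ^ (-((n:ℝ) + 1)) * w s) (Ioc 0 r₀) :=
    (continuousOn_id.rpow_const fun s hs => Or.inl hs.1.ne').mul hw
  have hint : ∀ x y : ℝ, 0 < x → x ≤ y → y ≤ r₀ →
      IntervalIntegrable (fun s : ℝ => s ^ (-((n:ℝ) + 1)) * w s) MeasureTheory.volume x y := by
    intro x y hx hxy hy
    refine (hcont.mono ?_).intervalIntegrable
    rw [uIcc_of_le hxy]
    exact fun s hs => ⟨hx.trans_le hs.1, hs.2.trans hy⟩
  set I := ∫ s in d..r₀, s ^ (-((n:ℝ) + 1)) * w s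
  set c := b - b / n with hc
  have hgap : 0 < K * (2 * b / (n * (n - 2))) := by positivity
  set M := C₀ - n * C₁ - n * K * I + K * d ^ (-(n:ℝ)) + n * K * c / (n - 2) * d ^ (2 - (n:ℝ))
    with hM
  have hlim : Tendsto (fun r : ℝ => K * (2 * b / (n * (n - 2))) * r ^ (2 - (n:ℝ)))
      (𝓝[>] 0) atTop :=
    (tendsto_rpow_neg_nhdsGT_zero (by linarith)).const_mul_atTop hgap
  obtain ⟨u, hu, hus⟩ := mem_nhdsGT_iff_exists_Ioo_subset.mp (hlim.eventually_gt_atTop M)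
  have hu0 : 0 < u := hu
  refine ⟨min u d, ⟨lt_min hu0 hd0, (min_le_right u d).trans_lt hdr⟩, fun r hr hr1 => ?_⟩
  have hrd : r < d := hr1.trans_le (min_le_right u d)
  have hbig : M < K * (2 * b / (n * (n - 2))) * r ^ (2 - (n:ℝ)) :=
    hus ⟨hr, hr1.trans_le (min_le_left u d)⟩
  have hvol : (r ^ (-(n:ℝ)) - d ^ (-(n:ℝ))) / n
      + c * ((r ^ (2 - (n:ℝ)) - d ^ (2 - (n:ℝ))) / (n - 2))
      ≤ ∫ s in r..d, s ^ (-((n:ℝ) + 1)) * w s := by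
    rw [← integral_rpow_neg_mul_one_add_sq (by linarith) hr hd0]
    refine intervalIntegral.integral_mono_on hrd.le ?_ (hint r d hr hrd.le hdr.le) ?_
    · refine ContinuousOn.intervalIntegrable ?_
      rw [uIcc_of_le hrd.le]
      exact (continuousOn_id.rpow_const fun s hs => Or.inl (hr.trans_le hs.1).ne').mul
        (by fun_prop)
    · intro s hs
      have hs0 : 0 < s := hr.trans_le hs.1
      have := (abs_le.mp (hwd s ⟨hs0, hs.2⟩)).1
      refine mul_le_mul_of_nonneg_left ?_ (Real.rpow_nonneg hs0.le _)
      rw [hc]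
      linarith
  have harea : r ^ (-(n:ℝ)) * w r ≤ r ^ (-(n:ℝ)) + (b + b / n) * r ^ (2 - (n:ℝ)) := by
    have hpow : r ^ (2 - (n:ℝ)) = r ^ (-(n:ℝ)) * r ^ 2 := by
      rw [← Real.rpow_two, ← Real.rpow_add hr]
      ring_nf
    have := (abs_le.mp (hwd r ⟨hr, hrd.le⟩)).2
    calc r ^ (-(n:ℝ)) * w r ≤ r ^ (-(n:ℝ)) * (1 + (b + b / n) * r ^ 2) :=
          mul_le_mul_of_nonneg_left (by linarith) (Real.rpow_nonneg hr.le _)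
      _ = _ := by rw [hpow]; ring
  rw [← intervalIntegral.integral_add_adjacent_intervals (hint r d hr hrd.le hdr.le)
    (hint d r₀ hd0 hdr.le le_rfl)]
  have harea' := mul_le_mul_of_nonneg_left harea hK.le
  have hvol' := mul_le_mul_of_nonneg_left hvol (mul_pos hn0 hK).le
  have hid : n * K * ((r ^ (-(n:ℝ)) - d ^ (-(n:ℝ))) / n
      + c * ((r ^ (2 - (n:ℝ)) - d ^ (2 - (n:ℝ))) / (n - 2)))
      - K * (r ^ (-(n:ℝ)) + (b + b / n) * r ^ (2 - (n:ℝ)))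
      = K * (2 * b / (n * (n - 2))) * r ^ (2 - (n:ℝ)) - K * d ^ (-(n:ℝ))
        - n * K * c / (n - 2) * d ^ (2 - (n:ℝ)) := by
    rw [hc]
    field_simp
    ring
  linarith
end

section
/- Let α ∈ (0,1), r₀ > 0, K > 0, C₀ ≥ 0, C₁ ≥ 0, and b > 0. Let w be a continuous function on (0, r₀] with w(s) = 1 + b s² + O(s^{2+α}) as s → 0⁺, meaning there exist C > 0 and δ ∈ (0, r₀] with |w(s) − (1 + b s²)| ≤ C s^{2+α} for all 0 < s < δ. Define, for r ∈ (0, r₀), A(r) = K r^{−2} w(r) + C₀ and V(r) = C₁ + K ∫_r^{r₀} s^{−3} w(s) ds. Then there exists r₁ ∈ (0, r₀) such that A(r) < 2 V(r) for all r ∈ (0, r₁). -/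
open Set MeasureTheory in
/-- If `w s ≥ 1 + c s²` on `(0, d]`, then `∫_r^d w(s) / s³ ds` grows at least like
`r⁻² / 2 + c log (1 / r)` as `r → 0⁺`. -/
theorem le_integral_div_cube_of_one_add_mul_sq_le {w : ℝ → ℝ} {c r d : ℝ} (hr : 0 < r)
    (hrd : r ≤ d) (hint : IntervalIntegrable (fun s => w s / s ^ 3) volume r d)
    (hw : ∀ s ∈ Icc r d, 1 + c * s ^ 2 ≤ w s) :
    (-(d ^ 2)⁻¹ / 2 + c * Real.log d) - (-(r ^ 2)⁻¹ / 2 + c * Real.log r)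
      ≤ ∫ s in r..d, w s / s ^ 3 := by
  have hcont : IntervalIntegrable (fun s : ℝ => (1 + c * s ^ 2) / s ^ 3) volume r d := by
    refine ContinuousOn.intervalIntegrable_of_Icc hrd ?_
    exact ContinuousOn.div (by fun_prop) (by fun_prop)
      fun s hs => (pow_pos (hr.trans_le hs.1) 3).ne'
  have hprim : ∫ s in r..d, (1 + c * s ^ 2) / s ^ 3
      = (-(d ^ 2)⁻¹ / 2 + c * Real.log d) - (-(r ^ 2)⁻¹ / 2 + c * Real.log r) := by
    refine intervalIntegral.integral_eq_sub_of_hasDerivAt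
      (f := fun s : ℝ => -(s ^ 2)⁻¹ / 2 + c * Real.log s) (fun s hs => ?_) hcont
    rw [uIcc_of_le hrd] at hs
    have hs0 : s ≠ 0 := (hr.trans_le hs.1).ne'
    have hderiv := (((hasDerivAt_pow 2 s).inv (pow_ne_zero 2 hs0)).neg.div_const 2).add
      ((Real.hasDerivAt_log hs0).const_mul c)
    refine hderiv.congr_deriv ?_
    norm_num
    field_simp
  rw [← hprim]
  refine intervalIntegral.integral_mono_on hrd hcont hint fun s hs => ?_
  have := hr.trans_le hs.1
  gcongr
  exact hw s hs

/-- Proposition 3.3, second part in dimension `n = 2`: with `w(s) = 1 + b s² + O(s^{2+α})`,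
`b > 0`, `A(r) = K r^{-2} w(r) + C₀` and `V(r) = C₁ + K ∫_r^{r₀} s^{-3} w(s) ds`,
one has `A(r) < 2 V(r)` for all sufficiently small `r > 0`. -/
theorem strict_isoperimetric_failure_dim2 (α : ℝ) (hα : α ∈ Set.Ioo (0:ℝ) 1)
    (r₀ K C₀ C₁ : ℝ) (hr₀ : 0 < r₀) (hK : 0 < K) (hC₀ : 0 ≤ C₀) (hC₁ : 0 ≤ C₁)
    (b : ℝ) (hb : 0 < b) (w : ℝ → ℝ)
    (hw : ContinuousOn w (Set.Ioc 0 r₀))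
    (hexp : ∃ C : ℝ, 0 < C ∧ ∃ δ ∈ Set.Ioc (0:ℝ) r₀, ∀ s : ℝ, 0 < s → s < δ →
      |w s - (1 + b * s ^ 2)| ≤ C * s ^ ((2:ℝ) + α)) :
    ∃ r₁ ∈ Set.Ioo (0:ℝ) r₀, ∀ r : ℝ, 0 < r → r < r₁ →
      K * r ^ (-(2:ℝ)) * w r + C₀ <
        2 * (C₁ + K * ∫ s in r..r₀, w s / s ^ 3) := by
  obtain ⟨C, hC, δ, ⟨hδ, hδr⟩, hexp⟩ := hexp
  obtain ⟨d, hd, hdδ, hdα⟩ :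
      ∃ d : ℝ, 0 < d ∧ d < δ ∧ ∀ s : ℝ, 0 < s → s ≤ d → C * s ^ α ≤ b / 2 := by
    have hq : 0 < b / (2 * C) := by positivity
    refine ⟨min (δ / 2) ((b / (2 * C)) ^ α⁻¹), by positivity,
      (min_le_left _ _).trans_lt (by linarith), fun s hs hsd => ?_⟩
    have h := Real.rpow_le_rpow hs.le (hsd.trans (min_le_right _ _)) hα.1.le
    rw [Real.rpow_inv_rpow hq.le hα.1.ne'] at h
    calc C * s ^ α ≤ C * (b / (2 * C)) := by gcongr
      _ = b / 2 := by field_simp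
  have hbound : ∀ s : ℝ, 0 < s → s ≤ d → |w s - (1 + b * s ^ 2)| ≤ b / 2 * s ^ 2 := by
    intro s hs hsd
    refine (hexp s hs (hsd.trans_lt hdδ)).trans ?_
    rw [Real.rpow_add hs, Real.rpow_two]
    nlinarith [mul_le_mul_of_nonneg_right (hdα s hs hsd) (sq_nonneg s)]
  have hdr : d < r₀ := hdδ.trans_le hδr
  have hint : ∀ x y : ℝ, 0 < x → x ≤ y → y ≤ r₀ →
      IntervalIntegrable (fun s => w s / s ^ 3) MeasureTheory.volume x y := by
    intro x y hx hxy hy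
    refine ContinuousOn.intervalIntegrable_of_Icc hxy ?_
    exact (hw.mono fun s hs => ⟨hx.trans_le hs.1, hs.2.trans hy⟩).div (by fun_prop)
      fun s hs => (pow_pos (hx.trans_le hs.1) 3).ne'
  set J := ∫ s in d..r₀, w s / s ^ 3
  set M := C₀ - 2 * C₁ + K * (3 * b / 2) + K * (d ^ 2)⁻¹ - 2 * K * J with hM
  refine ⟨min d (d * Real.exp (-(M / (K * b)))), ⟨by positivity,
    (min_le_left _ _).trans_lt hdr⟩, fun r hr hr₁ => ?_⟩
  have hrd : r < d := hr₁.trans_le (min_le_left _ _)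
  have hlog : M < K * b * (Real.log d - Real.log r) := by
    have h := Real.log_lt_log hr (hr₁.trans_le (min_le_right _ _))
    rw [Real.log_mul hd.ne' (Real.exp_pos _).ne', Real.log_exp] at h
    rw [mul_comm, ← div_lt_iff₀ (by positivity)]
    linarith
  have hlower := le_integral_div_cube_of_one_add_mul_sq_le (c := b / 2) hr hrd.le
    (hint r d hr hrd.le hdr.le) fun s hs => by
      linarith [(abs_le.1 (hbound s (hr.trans_le hs.1) hs.2)).1]
  rw [← intervalIntegral.integral_add_adjacent_intervals (hint r d hr hrd.le hdr.le)
    (hint d r₀ hd hdr.le le_rfl), Real.rpow_neg hr.le, Real.rpow_two]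
  have hA : K * (r ^ 2)⁻¹ * w r ≤ K * (r ^ 2)⁻¹ + K * (3 * b / 2) :=
    calc K * (r ^ 2)⁻¹ * w r ≤ K * (r ^ 2)⁻¹ * (1 + 3 * b / 2 * r ^ 2) := by
          gcongr
          linarith [(abs_le.1 (hbound r hr hrd.le)).2]
      _ = K * (r ^ 2)⁻¹ + K * (3 * b / 2) := by field_simp
  have hKlower := mul_le_mul_of_nonneg_left hlower hK.le
  linarith
end
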